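/- Let ℰ be a continuous signature, K a class of topological ℰ-algebras, and X a topological space admitting a free universal algebra (F(X), i_X) in K. Endow HM(X) and HM(F(X)) with the Hartman–Mycielski topology, and HM(F(X)) with the pointwise operations inherited from F(X). Suppose HM(F(X)) ∈ K and that HM(X) admits a free universal algebra (F(HM(X)), i_{HM(X)}) in K. Let h : F(HM(X)) → HM(F(X)) be the unique continuous homomorphism with h ∘ i_{HM(X)} = HM(i_X), and let F(hm_X) : F(X) → F(HM(X)) be the unique continuous homomorphism with F(hm_X) ∘ i_X = i_{HM(X)} ∘ hm_X. Then h ∘ F(hm_X) = hm_{F(X)}. -/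

import Mathlib

open Set MeasureTheory Topology

universe u v

namespace HMPaper

abbrev I01 : Set ℝ := Set.Ico (0:ℝ) 1

def IsStep {X : Type u} (f : I01 → X) : Prop :=
  ∃ (n : ℕ) (a : Fin (n + 1) → ℝ), a 0 = 0 ∧ a (Fin.last n) = 1 ∧ StrictMono a ∧
    ∀ (i : Fin n) (s t : I01), (s : ℝ) ∈ Set.Ico (a i.castSucc) (a i.succ) →
      (t : ℝ) ∈ Set.Ico (a i.castSucc) (a i.succ) → f s = f t

def HM (X : Type u) : Type u := {f : I01 → X // IsStep f}

theorem isStep_const {X : Type u} (x : X) : IsStep (fun _ : I01 => x) := by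
  refine ⟨1, ![0, 1], rfl, rfl, ?_, fun i s t _ _ => rfl⟩
  intro i j hij
  fin_cases i <;> fin_cases j <;> simp_all

def hmConst {X : Type u} (x : X) : HM X := ⟨fun _ => x, isStep_const x⟩

theorem isStep_comp {X : Type u} {Y : Type v} (p : X → Y) {f : I01 → X}
    (hf : IsStep f) : IsStep (fun t => p (f t)) := by
  obtain ⟨n, a, h0, h1, hm, hc⟩ := hf
  exact ⟨n, a, h0, h1, hm, fun i s t hs ht => congrArg p (hc i s t hs ht)⟩

def hmMap {X : Type u} {Y : Type v} (p : X → Y) (f : HM X) : HM Y :=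
  ⟨fun t => p (f.1 t), isStep_comp p f.2⟩

/-- The basic set `N(a,b,V,ε)` of the Hartman–Mycielski topology: all step functions `g`
with `λ {t ∈ [a,b) : g(t) ∉ V} < ε` (`λ` being Lebesgue measure). -/
def hmBasicSet {X : Type u} (a b : ℝ) (V : Set X) (ε : ℝ) : Set (HM X) :=
  {g : HM X | MeasureTheory.volume
    {t : ℝ | ∃ ht : t ∈ I01, t ∈ Set.Ico a b ∧ g.1 ⟨t, ht⟩ ∉ V} < ENNReal.ofReal ε}

/-- The neighborhood subbase of the Hartman–Mycielski topology at a step function `f`: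
all sets `N(a,b,V,ε)` where `0 ≤ a < b ≤ 1`, `f` is constant on `[a,b)`, `V` is a
neighborhood of `f(a)` and `ε > 0`. -/
def hmSubbasis {X : Type u} [TopologicalSpace X] (f : HM X) : Set (Set (HM X)) :=
  {S | ∃ (a b : ℝ) (ha : 0 ≤ a) (hab : a < b) (hb : b ≤ 1) (V : Set X) (ε : ℝ),
    0 < ε ∧
    (∀ s t : I01, (s : ℝ) ∈ Set.Ico a b → (t : ℝ) ∈ Set.Ico a b → f.1 s = f.1 t) ∧
    V ∈ nhds (f.1 ⟨a, ha, hab.trans_le hb⟩) ∧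
    S = hmBasicSet a b V ε}

/-- The Hartman–Mycielski topology on `HM X`: the topology whose neighborhood filter at
each `f` is generated by the neighborhood subbase `hmSubbasis f`. -/
instance hmTopologicalSpace (X : Type u) [TopologicalSpace X] : TopologicalSpace (HM X) :=
  TopologicalSpace.mkOfNhds fun f => Filter.generate (hmSubbasis f)

theorem exists_mem_cell {n : ℕ} (a : Fin (n + 1) → ℝ) (x : ℝ)
    (h0 : a 0 ≤ x) (h1 : x < a (Fin.last n)) :
    ∃ i : Fin n, a i.castSucc ≤ x ∧ x < a i.succ := by
  classical
  have hne : (Finset.univ.filter (fun i : Fin (n + 1) => a i ≤ x)).Nonempty :=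
    ⟨0, by simpa using h0⟩
  set M := (Finset.univ.filter (fun i : Fin (n + 1) => a i ≤ x)).max' hne with hM
  have hMle : a M ≤ x := by
    have := (Finset.univ.filter (fun i : Fin (n + 1) => a i ≤ x)).max'_mem hne
    simpa using this
  have hMne : M ≠ Fin.last n := by
    intro h
    rw [h] at hMle
    exact absurd h1 (not_lt.2 hMle)
  have hMlt : (M : ℕ) < n := by
    have := Fin.lt_last_iff_ne_last.2 hMne
    simpa [Fin.lt_def] using this
  refine ⟨⟨M, hMlt⟩, ?_, ?_⟩
  · have : (⟨M, hMlt⟩ : Fin n).castSucc = M := by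
      simp [Fin.castSucc, Fin.ext_iff]
    rw [this]; exact hMle
  · by_contra h
    push_neg at h
    have hmem : (⟨M, hMlt⟩ : Fin n).succ ∈
        Finset.univ.filter (fun i : Fin (n + 1) => a i ≤ x) := by
      simp only [Finset.mem_filter, Finset.mem_univ, true_and]
      exact h
    have hle := Finset.le_max' _ _ hmem
    rw [← hM] at hle
    have : (M : ℕ) + 1 ≤ (M : ℕ) := by
      simpa [Fin.le_def] using hle
    omega

theorem isStep_combine {X : Type u} {Y : Type v} {k : ℕ} (f : Fin k → I01 → X)
    (hf : ∀ i, IsStep (f i)) (g : (Fin k → X) → Y) :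
    IsStep (fun t => g (fun i => f i t)) := by
  classical
  choose n a h0 h1 hmono hconst using hf
  set D : Finset ℝ :=
    insert (0:ℝ) (insert 1 (Finset.univ.biUnion fun i : Fin k =>
      Finset.univ.image (a i))) with hD
  have h0D : (0:ℝ) ∈ D := by simp [hD]
  have h1D : (1:ℝ) ∈ D := by simp [hD]
  have hDmem : ∀ x ∈ D, 0 ≤ x ∧ x ≤ 1 := by
    intro x hx
    simp only [hD, Finset.mem_insert, Finset.mem_biUnion, Finset.mem_image,
      Finset.mem_univ, true_and] at hx
    rcases hx with rfl | rfl | ⟨i, j, rfl⟩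
    · norm_num
    · norm_num
    · constructor
      · have := (hmono i).monotone (Fin.zero_le j)
        rw [h0 i] at this; exact this
      · have := (hmono i).monotone (Fin.le_last j)
        rw [h1 i] at this; exact this
  obtain ⟨m, hm⟩ : ∃ m, D.card = m + 1 := by
    have : D.Nonempty := ⟨0, h0D⟩
    have := Finset.card_pos.2 this
    exact ⟨D.card - 1, by omega⟩
  set b : Fin (m + 1) → ℝ := fun j => ((D.orderIsoOfFin hm j : ℝ)) with hb
  have hbmono : StrictMono b := fun i j hij => by
    exact_mod_cast (D.orderIsoOfFin hm).strictMono hij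
  have hbD : ∀ j, b j ∈ D := fun j => (D.orderIsoOfFin hm j).2
  have hbsurj : ∀ x ∈ D, ∃ j, b j = x := by
    intro x hx
    obtain ⟨j, hj⟩ := (D.orderIsoOfFin hm).surjective ⟨x, hx⟩
    exact ⟨j, by rw [hb]; exact congrArg Subtype.val hj⟩
  have hb0 : b 0 = 0 := by
    obtain ⟨j, hj⟩ := hbsurj 0 h0D
    have h1' : b 0 ≤ b j := hbmono.monotone (Fin.zero_le j)
    rw [hj] at h1'
    exact le_antisymm h1' (hDmem _ (hbD 0)).1
  have hb1 : b (Fin.last m) = 1 := by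
    obtain ⟨j, hj⟩ := hbsurj 1 h1D
    have h1' : b j ≤ b (Fin.last m) := hbmono.monotone (Fin.le_last j)
    rw [hj] at h1'
    exact le_antisymm (hDmem _ (hbD _)).2 h1'
  have hcell : ∀ (j : Fin m) (x : ℝ), x ∈ D → b j.castSucc < x → x < b j.succ → False := by
    intro j x hx hlt hlt'
    obtain ⟨l, rfl⟩ := hbsurj x hx
    have h1' : j.castSucc < l := hbmono.lt_iff_lt.1 hlt
    have h2' : l < j.succ := hbmono.lt_iff_lt.1 hlt'
    rw [Fin.lt_def] at h1' h2'
    simp only [Fin.coe_castSucc, Fin.val_succ] at h1' h2'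
    omega
  refine ⟨m, b, hb0, hb1, hbmono, ?_⟩
  intro j s t hs ht
  refine congrArg g (funext fun i => ?_)
  have hs0 : a i 0 ≤ (s : ℝ) := by rw [h0 i]; exact s.2.1
  have hs1 : (s : ℝ) < a i (Fin.last (n i)) := by rw [h1 i]; exact s.2.2
  obtain ⟨idx, hidx1, hidx2⟩ := exists_mem_cell (a i) s hs0 hs1
  have hlowD : a i idx.castSucc ∈ D := by
    simp only [hD, Finset.mem_insert, Finset.mem_biUnion, Finset.mem_image,
      Finset.mem_univ, true_and]
    exact Or.inr (Or.inr ⟨i, idx.castSucc, rfl⟩)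
  have hupD : a i idx.succ ∈ D := by
    simp only [hD, Finset.mem_insert, Finset.mem_biUnion, Finset.mem_image,
      Finset.mem_univ, true_and]
    exact Or.inr (Or.inr ⟨i, idx.succ, rfl⟩)
  have hlow : a i idx.castSucc ≤ b j.castSucc := by
    by_contra h
    push_neg at h
    exact hcell j _ hlowD h (lt_of_le_of_lt hidx1 hs.2)
  have hup : b j.succ ≤ a i idx.succ := by
    by_contra h
    push_neg at h
    exact hcell j _ hupD (lt_of_le_of_lt hs.1 hidx2) h
  exact hconst i idx s t ⟨hidx1, hidx2⟩
    ⟨le_trans hlow ht.1, lt_of_lt_of_le ht.2 hup⟩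

/-! ### Universal topological algebras of continuous signature -/

/-- A topological `ℰ`-algebra (the algebraic data): a topological space together with
operations `eₙ : Eₙ × Xⁿ → X`.  Continuity of the operations is expressed by
`ContinuousOps`. -/
structure EAlg (E : ℕ → Type u) [∀ n, TopologicalSpace (E n)] : Type (u + 1) where
  carrier : Type u
  top : TopologicalSpace carrier
  ops : ∀ n : ℕ, E n × (Fin n → carrier) → carrier

attribute [instance] EAlg.top

variable {E : ℕ → Type u} [∀ n, TopologicalSpace (E n)]

/-- The algebraic operations of `A` are all continuous, i.e. `A` is a topological
`ℰ`-algebra in the sense of Choban. -/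
def ContinuousOps (A : EAlg E) : Prop := ∀ n : ℕ, Continuous (A.ops n)

/-- A homomorphism of `ℰ`-algebras. -/
def IsHom (A B : EAlg E) (h : A.carrier → B.carrier) : Prop :=
  ∀ (n : ℕ) (c : E n) (x : Fin n → A.carrier),
    h (A.ops n (c, x)) = B.ops n (c, fun i => h (x i))

/-- `(F, i)` is a free universal `ℰ`-algebra of the space `X` in the class `K`. -/
def IsFreeAlg (K : EAlg E → Prop) (X : Type u) [TopologicalSpace X]
    (F : EAlg E) (i : X → F.carrier) : Prop :=
  K F ∧ Continuous i ∧
    ∀ B : EAlg E, K B → ∀ f : X → B.carrier, Continuous f →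
      ∃! h : F.carrier → B.carrier,
        Continuous h ∧ IsHom F B h ∧ ∀ x, h (i x) = f x

/-- `S` is (the underlying set of) a subalgebra of `A`. -/
def IsSubalgebra (A : EAlg E) (S : Set A.carrier) : Prop :=
  ∀ (n : ℕ) (c : E n) (x : Fin n → A.carrier), (∀ i, x i ∈ S) → A.ops n (c, x) ∈ S

/-- The subalgebra of `A` on a closed-under-operations subset `S`, with the subspace
topology. -/
def Subalg (A : EAlg E) (S : Set A.carrier) (hS : IsSubalgebra A S) : EAlg E where
  carrier := S
  top := inferInstance
  ops := fun n p => ⟨A.ops n (p.1, fun i => (p.2 i : A.carrier)),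
    hS n p.1 _ fun i => (p.2 i).2⟩

/-- The Cartesian product of a family of `ℰ`-algebras, with the product topology and
pointwise operations. -/
def ProdAlg {ι : Type u} (A : ι → EAlg E) : EAlg E where
  carrier := ∀ i, (A i).carrier
  top := inferInstance
  ops := fun n p i => (A i).ops n (p.1, fun j => p.2 j i)

/-- A quasivariety: a class of `ℰ`-algebras closed under subalgebras and arbitrary
Cartesian products. -/
def IsQuasivariety (K : EAlg E → Prop) : Prop :=
  (∀ (A : EAlg E) (S : Set A.carrier) (hS : IsSubalgebra A S), K A → K (Subalg A S hS)) ∧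
  (∀ (ι : Type u) (A : ι → EAlg E), (∀ i, K (A i)) → K (ProdAlg A))

/-- A complete quasivariety: a quasivariety containing every completely regular
`ℰ`-algebra algebraically isomorphic to one of its members. -/
def IsCompleteQuasivariety (K : EAlg E → Prop) : Prop :=
  IsQuasivariety K ∧
  ∀ A B : EAlg E, K B → CompletelyRegularSpace A.carrier →
    (∃ h : A.carrier → B.carrier, Function.Bijective h ∧ IsHom A B h) → K A

/-- The pointwise operations on `HM X` induced from operations on `X`. -/
def hmOps {X : Type u} (e : ∀ n : ℕ, E n × (Fin n → X) → X) (n : ℕ)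
    (p : E n × (Fin n → HM X)) : HM X :=
  ⟨fun t => e n (p.1, fun i => (p.2 i).1 t),
    isStep_combine (fun i => (p.2 i).1) (fun i => (p.2 i).2) (fun v => e n (p.1, v))⟩

/-- The Hartman–Mycielski algebra `HM(A)` of an `ℰ`-algebra `A`: step functions with
the Hartman–Mycielski topology and pointwise operations. -/
def HMAlg (A : EAlg E) : EAlg E where
  carrier := HM A.carrier
  top := hmTopologicalSpace A.carrier
  ops := hmOps A.ops

/-- A stratifiable space: a regular space with a monotone stratification `G`. -/
def Stratifiable (X : Type u) [TopologicalSpace X] : Prop :=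
  RegularSpace X ∧
  ∃ G : ℕ → Set X → Set X,
    (∀ (n : ℕ) (H : Set X), IsClosed H → IsOpen (G n H) ∧ H ⊆ G n H) ∧
    (∀ H : Set X, IsClosed H → H = ⋂ n : ℕ, closure (G n H)) ∧
    (∀ (n : ℕ) (H K : Set X), IsClosed H → IsClosed K → H ⊆ K → G n H ⊆ G n K)


theorem continuous_hmConst {X : Type u} [TopologicalSpace X] :
    Continuous (hmConst : X → HM X) := by
  refine continuous_def.2 fun S hS => isOpen_iff_mem_nhds.2 fun x hx => ?_
  have hle : Filter.map hmConst (𝓝 x) ≤ Filter.generate (hmSubbasis (hmConst x)) := by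
    rw [Filter.le_generate_iff]
    rintro _ ⟨a, b, _, _, _, V, ε, hε, -, hV, rfl⟩
    refine Filter.mem_map.2 (Filter.mem_of_superset hV fun y hy => ?_)
    have hempty : {t : ℝ | ∃ ht : t ∈ I01, t ∈ Set.Ico a b ∧
        (hmConst y).1 ⟨t, ht⟩ ∉ V} = ∅ :=
      Set.eq_empty_of_forall_notMem fun _ ⟨_, _, h⟩ => h hy
    change volume _ < _
    rw [hempty, measure_empty]
    exact ENNReal.ofReal_pos.2 hε
  exact hle (hS (hmConst x) hx)

theorem isHom_hmConst (A : EAlg E) : IsHom A (HMAlg A) hmConst := fun _ _ _ => rfl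

theorem IsHom.comp {A B C : EAlg E} {g : B.carrier → C.carrier} {f : A.carrier → B.carrier}
    (hg : IsHom B C g) (hf : IsHom A B f) : IsHom A C (g ∘ f) := fun n c x => by
  simp only [Function.comp_apply, hf n c x, hg n c]

/-- The key identity in the proof of Theorem 2: `h ∘ F(hm_X) = hm_{F(X)}`, where `h` is
the canonical homomorphism `F(HM(X)) → HM(F(X))` with `h ∘ i_{HM(X)} = HM(i_X)` and
`F(hm_X) : F(X) → F(HM(X))` satisfies `F(hm_X) ∘ i_X = i_{HM(X)} ∘ hm_X`. -/
theorem comp_free_hmConst_eq_hmConst {E : ℕ → Type u} [∀ n, TopologicalSpace (E n)]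
    (K : EAlg E → Prop) (X : Type u) [TopologicalSpace X]
    (F : EAlg E) (iX : X → F.carrier) (hF : IsFreeAlg K X F iX)
    (hHMF : K (HMAlg F))
    (FHM : EAlg E) (iHM : HM X → FHM.carrier) (hFHM : IsFreeAlg K (HM X) FHM iHM)
    (h : FHM.carrier → HM F.carrier)
    (hh : Continuous h ∧ IsHom FHM (HMAlg F) h ∧ ∀ g : HM X, h (iHM g) = hmMap iX g)
    (Fhm : F.carrier → FHM.carrier)
    (hFhm : Continuous Fhm ∧ IsHom F FHM Fhm ∧ ∀ x, Fhm (iX x) = iHM (hmConst x)) :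
    ∀ w : F.carrier, h (Fhm w) = hmConst w := by
  obtain ⟨hh_cont, hh_hom, hh_ext⟩ := hh
  obtain ⟨hFhm_cont, hFhm_hom, hFhm_ext⟩ := hFhm
  have hcont : Continuous (hmConst : F.carrier → HM F.carrier) := continuous_hmConst
  refine congrFun ((hF.2.2 (HMAlg F) hHMF (hmConst ∘ iX) (hcont.comp hF.2.1)).unique
    (y₁ := h ∘ Fhm) (y₂ := hmConst)
    ⟨hh_cont.comp hFhm_cont, hh_hom.comp hFhm_hom, fun x => ?_⟩
    ⟨hcont, isHom_hmConst F, fun _ => rfl⟩)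
  exact (congrArg h (hFhm_ext x)).trans (hh_ext (hmConst x))

end HMPaper
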